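/- arXiv:1411.7284 — 2 statements merged into one kernel-verified Lean document; each statement's English description precedes it below -/
import Mathlib

section
/- For every β ∈ (0,1) and every T > 0, the functions χ_ε converge uniformly on [0, T] to the function t ↦ t^β as ε → 0⁺; that is, sup_{t ∈ [0,T]} |χ_ε(t) − t^β| → 0 as ε → 0⁺. -/
open MeasureTheory Set Filter

/-- The Campana–Guenancia–Păun smoothing function
`χ_ε(t) = β · ∫₀ᵗ ((ε² + r)^β − ε^{2β})/r dr` (powers are real powers). -/
noncomputable def chi (β ε t : ℝ) : ℝ :=
  β * ∫ r in (0:ℝ)..t, ((ε ^ 2 + r) ^ β - ε ^ (2 * β)) / r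

/-- The integrand of `chi` is squeezed between `0` and `r ^ (β - 1)`. -/
lemma chi_integrand_mem_Icc {β ε r : ℝ} (hβ : β ∈ Set.Ioo (0:ℝ) 1) (hε : 0 < ε) (hr : 0 < r) :
    ((ε ^ 2 + r) ^ β - ε ^ (2 * β)) / r ∈ Set.Icc 0 (r ^ (β - 1)) := by
  have hpow : ε ^ (2 * β) = (ε ^ 2) ^ β := by
    rw [Real.rpow_mul hε.le, Real.rpow_two]
  rw [hpow]
  constructor
  · exact div_nonneg (sub_nonneg.2 (Real.rpow_le_rpow (by positivity) (by linarith) hβ.1.le)) hr.le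
  · rw [Real.rpow_sub_one hr.ne']
    gcongr
    linarith [Real.rpow_add_le_add_rpow (sq_nonneg ε) hr.le hβ.1.le hβ.2.le]

lemma measurable_chi_integrand (β ε : ℝ) :
    Measurable fun r : ℝ => ((ε ^ 2 + r) ^ β - ε ^ (2 * β)) / r := by
  fun_prop

lemma intervalIntegrable_chi_integrand {β ε t : ℝ} (hβ : β ∈ Set.Ioo (0:ℝ) 1) (hε : 0 < ε)
    (ht : 0 ≤ t) :
    IntervalIntegrable (fun r : ℝ => ((ε ^ 2 + r) ^ β - ε ^ (2 * β)) / r) volume 0 t := by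
  refine (intervalIntegral.intervalIntegrable_rpow' (r := β - 1) (by linarith [hβ.1])).mono_fun
    (measurable_chi_integrand β ε).aestronglyMeasurable ?_
  filter_upwards [ae_restrict_mem measurableSet_uIoc] with r hr
  rw [uIoc_of_le ht] at hr
  have h := chi_integrand_mem_Icc hβ hε hr.1
  rw [Real.norm_of_nonneg h.1, Real.norm_of_nonneg (h.1.trans h.2)]
  exact h.2

lemma rpow_eq_mul_integral {β : ℝ} (hβ : 0 < β) (t : ℝ) :
    t ^ β = β * ∫ r in (0:ℝ)..t, r ^ (β - 1) := by
  rw [integral_rpow (Or.inl (by linarith)), sub_add_cancel, Real.zero_rpow hβ.ne']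
  field_simp
  ring

lemma rpow_sub_chi {β ε t : ℝ} (hβ : β ∈ Set.Ioo (0:ℝ) 1) (hε : 0 < ε) (ht : 0 ≤ t) :
    t ^ β - chi β ε t =
      β * ∫ r in (0:ℝ)..t, (r ^ (β - 1) - ((ε ^ 2 + r) ^ β - ε ^ (2 * β)) / r) := by
  rw [intervalIntegral.integral_sub
    (intervalIntegral.intervalIntegrable_rpow' (by linarith [hβ.1]))
    (intervalIntegrable_chi_integrand hβ hε ht), mul_sub, ← rpow_eq_mul_integral hβ.1, chi]

lemma rpow_sub_chi_nonneg {β ε t : ℝ} (hβ : β ∈ Set.Ioo (0:ℝ) 1) (hε : 0 < ε) (ht : 0 ≤ t) :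
    0 ≤ t ^ β - chi β ε t := by
  rw [rpow_sub_chi hβ hε ht, intervalIntegral.integral_of_le ht]
  exact mul_nonneg hβ.1.le (setIntegral_nonneg measurableSet_Ioc fun r hr =>
    sub_nonneg.2 (chi_integrand_mem_Icc hβ hε hr.1).2)

lemma rpow_sub_chi_mono {β ε t T : ℝ} (hβ : β ∈ Set.Ioo (0:ℝ) 1) (hε : 0 < ε) (ht : 0 ≤ t)
    (htT : t ≤ T) : t ^ β - chi β ε t ≤ T ^ β - chi β ε T := by
  have hT := ht.trans htT
  rw [rpow_sub_chi hβ hε ht, rpow_sub_chi hβ hε hT]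
  refine mul_le_mul_of_nonneg_left ?_ hβ.1.le
  refine intervalIntegral.integral_mono_interval le_rfl ht htT ?_
    ((intervalIntegral.intervalIntegrable_rpow' (by linarith [hβ.1])).sub
      (intervalIntegrable_chi_integrand hβ hε hT))
  filter_upwards [ae_restrict_mem measurableSet_Ioc] with r hr
  exact sub_nonneg.2 (chi_integrand_mem_Icc hβ hε hr.1).2

lemma tendsto_chi {β T : ℝ} (hβ : β ∈ Set.Ioo (0:ℝ) 1) (hT : 0 ≤ T) :
    Tendsto (fun ε => chi β ε T) (nhdsWithin 0 (Set.Ioi 0)) (nhds (T ^ β)) := by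
  rw [rpow_eq_mul_integral hβ.1]
  refine Tendsto.const_mul β ?_
  refine intervalIntegral.tendsto_integral_filter_of_dominated_convergence
    (fun r => r ^ (β - 1)) ?_ ?_
    (intervalIntegral.intervalIntegrable_rpow' (by linarith [hβ.1])) ?_
  · exact Eventually.of_forall fun ε => (measurable_chi_integrand β ε).aestronglyMeasurable
  · filter_upwards [self_mem_nhdsWithin] with ε hε
    refine Eventually.of_forall fun r hr => ?_
    rw [uIoc_of_le hT] at hr
    have h := chi_integrand_mem_Icc hβ hε hr.1
    rw [Real.norm_of_nonneg h.1]
    exact h.2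
  · refine Eventually.of_forall fun r hr => ?_
    rw [uIoc_of_le hT] at hr
    have hβ0 := hβ.1
    have hcont : ContinuousAt (fun ε : ℝ => ((ε ^ 2 + r) ^ β - ε ^ (2 * β)) / r) 0 := by
      refine ContinuousAt.div_const (ContinuousAt.sub ?_ ?_) r
      · exact ContinuousAt.rpow_const (by fun_prop) (Or.inr hβ0.le)
      · exact ContinuousAt.rpow_const continuousAt_id (Or.inr (by positivity))
    have h := hcont.tendsto.mono_left (nhdsWithin_le_nhds (s := Set.Ioi (0:ℝ)))
    simpa [Real.zero_rpow (mul_pos two_pos hβ0).ne', Real.rpow_sub_one hr.1.ne', hβ0.ne'] using h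

theorem chi_tendstoUniformlyOn (β T : ℝ) (hβ : β ∈ Set.Ioo (0:ℝ) 1) (hT : 0 < T) :
    TendstoUniformlyOn (fun ε t => chi β ε t) (fun t => t ^ β)
      (nhdsWithin 0 (Set.Ioi 0)) (Set.Icc 0 T) := by
  rw [Metric.tendstoUniformlyOn_iff]
  intro δ hδ
  filter_upwards [self_mem_nhdsWithin,
    Metric.tendsto_nhds.1 (tendsto_chi hβ hT.le) δ hδ] with ε hε hd t ht
  rw [dist_comm, Real.dist_eq, abs_of_nonneg (rpow_sub_chi_nonneg hβ hε hT.le)] at hd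
  rw [Real.dist_eq, abs_of_nonneg (rpow_sub_chi_nonneg hβ hε ht.1)]
  exact (rpow_sub_chi_mono hβ hε ht.1 ht.2).trans_lt hd
end

section
/- For every β ∈ (0,1) and ε > 0, the function Φ_ε : ℂ → ℝ defined by Φ_ε(z) = χ_ε(‖z‖²) is smooth, and its Laplacian (the trace of its second derivative as a function on ℝ² ≅ ℂ) satisfies ΔΦ_ε(z) = 4β²·(ε² + ‖z‖²)^{β−1} for every z ∈ ℂ; in particular ΔΦ_ε > 0 everywhere, so Φ_ε is subharmonic on ℂ. -/
open MeasureTheory Set Filter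

/-- The smoothed conic potential `Φ_ε(z) = χ_ε(‖z‖²)` in the flat local model. -/
noncomputable def Phi (β ε : ℝ) (z : ℂ) : ℝ := chi β ε (‖z‖ ^ 2)

/-- The Laplacian of a function `f : ℂ → ℝ`, i.e. the trace of its second derivative
as a function on `ℝ² ≅ ℂ`, computed in the orthonormal basis `{1, i}`. -/
noncomputable def complexLaplacian (f : ℂ → ℝ) (z : ℂ) : ℝ :=
  iteratedFDeriv ℝ 2 f z ![1, 1] + iteratedFDeriv ℝ 2 f z ![Complex.I, Complex.I]

/-- A `C²` function on `ℂ` is subharmonic iff its Laplacian is everywhere nonnegative. -/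
def IsSubharmonic (f : ℂ → ℝ) : Prop :=
  ContDiff ℝ 2 f ∧ ∀ z : ℂ, 0 ≤ complexLaplacian f z

theorem AnalyticAt.dslope {𝕜 E : Type*} [NontriviallyNormedField 𝕜] [NormedAddCommGroup E]
    [NormedSpace 𝕜 E] {f : 𝕜 → E} {a b : 𝕜} (ha : AnalyticAt 𝕜 f a) (hb : AnalyticAt 𝕜 f b) :
    AnalyticAt 𝕜 (dslope f a) b := by
  rcases eq_or_ne b a with rfl | hne
  · obtain ⟨p, hp⟩ := hb
    exact ⟨_, hp.has_fpower_series_dslope_fslope⟩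
  · refine AnalyticAt.congr ?_ (dslope_eventuallyEq_slope_of_ne f hne).symm
    exact ((analyticAt_id.sub analyticAt_const).inv (sub_ne_zero.2 hne)).smul
      (hb.sub analyticAt_const)

theorem iteratedFDeriv_two_comp_norm_sq {E : Type*} [NormedAddCommGroup E]
    [InnerProductSpace ℝ E] {g g' : ℝ → ℝ} {g'' : ℝ} {z : E}
    (hg : ∀ᶠ t in nhds (‖z‖ ^ 2), HasDerivAt g (g' t) t) (hg' : HasDerivAt g' g'' (‖z‖ ^ 2))
    (v : E) :
    iteratedFDeriv ℝ 2 (fun w : E => g (‖w‖ ^ 2)) z ![v, v] =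
      g'' * (2 * inner ℝ z v) ^ 2 + g' (‖z‖ ^ 2) * (2 * ‖v‖ ^ 2) := by
  have hcont : Tendsto (fun w : E => ‖w‖ ^ 2) (nhds z) (nhds (‖z‖ ^ 2)) :=
    (continuous_norm.pow 2).tendsto z
  have hfderiv : fderiv ℝ (fun w : E => g (‖w‖ ^ 2)) =ᶠ[nhds z]
      fun w => g' (‖w‖ ^ 2) • (2 • innerSL ℝ w) := by
    filter_upwards [hcont.eventually hg] with w hw
    exact (hw.comp_hasFDerivAt w (hasStrictFDerivAt_norm_sq w).hasFDerivAt).fderiv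
  have hc : HasFDerivAt (fun w : E => g' (‖w‖ ^ 2)) (g'' • (2 • innerSL ℝ z)) z :=
    hg'.comp_hasFDerivAt z (hasStrictFDerivAt_norm_sq z).hasFDerivAt
  have hL : HasFDerivAt (fun w : E => 2 • innerSL ℝ w) (2 • innerSL ℝ : E →L[ℝ] E →L[ℝ] ℝ) z :=
    (2 • innerSL ℝ : E →L[ℝ] E →L[ℝ] ℝ).hasFDerivAt
  rw [iteratedFDeriv_two_apply, hfderiv.fderiv_eq, (hc.fun_smul hL).fderiv]
  have hv : (innerSL ℝ : E →L[ℝ] E →L[ℝ] ℝ) v v = ‖v‖ ^ 2 := real_inner_self_eq_norm_sq v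
  simp [hv]
  ring

theorem complexLaplacian_comp_norm_sq {g g' : ℝ → ℝ} {g'' : ℝ} {z : ℂ}
    (hg : ∀ᶠ t in nhds (‖z‖ ^ 2), HasDerivAt g (g' t) t) (hg' : HasDerivAt g' g'' (‖z‖ ^ 2)) :
    complexLaplacian (fun w => g (‖w‖ ^ 2)) z =
      4 * (g' (‖z‖ ^ 2) + ‖z‖ ^ 2 * g'') := by
  have hz : ‖z‖ ^ 2 = z.re ^ 2 + z.im ^ 2 := by
    rw [Complex.sq_norm, Complex.normSq_apply]
    ring
  rw [complexLaplacian, iteratedFDeriv_two_comp_norm_sq hg hg',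
    iteratedFDeriv_two_comp_norm_sq hg hg', hz]
  simp [Complex.inner]
  ring

theorem analyticAt_add_rpow_const {c t : ℝ} (β : ℝ) (ht : c + t ≠ 0) :
    AnalyticAt ℝ (fun r : ℝ => (c + r) ^ β) t :=
  ((contDiffAt_const.add contDiffAt_id).rpow_const_of_ne ht : ContDiffAt ℝ ⊤ _ t).analyticAt

theorem analyticAt_dslope_add_rpow_const {c t : ℝ} (β : ℝ) (hc : 0 < c) (ht : -c < t) :
    AnalyticAt ℝ (dslope (fun r : ℝ => (c + r) ^ β) 0) t :=
  (analyticAt_add_rpow_const β (by linarith)).dslope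
    (analyticAt_add_rpow_const β (by linarith))

theorem chi_eq_integral_dslope (β : ℝ) {ε : ℝ} (hε : 0 < ε) (t : ℝ) :
    chi β ε t = β * ∫ r in (0:ℝ)..t, dslope (fun r : ℝ => (ε ^ 2 + r) ^ β) 0 r := by
  rw [chi, intervalIntegral.integral_congr_uIoo]
  intro r hr
  have hr0 : r ≠ 0 := fun h => by
    simp [h, uIoo] at hr
    linarith
  simp only [dslope_of_ne _ hr0, slope_def_field, add_zero, sub_zero, Real.rpow_mul hε.le,
    Real.rpow_two]

theorem hasDerivAt_chi (β : ℝ) {ε t : ℝ} (hε : 0 < ε) (ht : -ε ^ 2 < t) :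
    HasDerivAt (chi β ε) (β * dslope (fun r : ℝ => (ε ^ 2 + r) ^ β) 0 t) t := by
  have hε2 : 0 < ε ^ 2 := by positivity
  have hcont : ContinuousOn (dslope (fun r : ℝ => (ε ^ 2 + r) ^ β) 0) (Ioi (-ε ^ 2)) :=
    fun r hr => (analyticAt_dslope_add_rpow_const β hε2 hr).continuousAt.continuousWithinAt
  rw [funext (chi_eq_integral_dslope β hε)]
  refine (intervalIntegral.integral_hasDerivAt_right ?_
    (hcont.stronglyMeasurableAtFilter isOpen_Ioi t ht)
    (hcont.continuousAt (Ioi_mem_nhds ht))).const_mul β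
  exact (hcont.mono (ordConnected_Ioi.uIcc_subset (neg_lt_zero.2 hε2) ht)).intervalIntegrable

theorem contDiffOn_chi (β : ℝ) {ε : ℝ} (hε : 0 < ε) :
    ContDiffOn ℝ (⊤ : ℕ∞) (chi β ε) (Ioi (-ε ^ 2)) := by
  refine (contDiffOn_infty_iff_deriv_of_isOpen isOpen_Ioi).2
    ⟨fun t ht => (hasDerivAt_chi β hε ht).differentiableAt.differentiableWithinAt, ?_⟩
  refine ContDiffOn.congr ?_ fun t ht => (hasDerivAt_chi β hε ht).deriv
  exact fun t ht => (contDiffAt_const.mul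
    (analyticAt_dslope_add_rpow_const β (by positivity) ht).contDiffAt).contDiffWithinAt

theorem contDiff_Phi (β : ℝ) {ε : ℝ} (hε : 0 < ε) : ContDiff ℝ (⊤ : ℕ∞) (Phi β ε) := by
  refine (contDiffOn_chi β hε).comp_contDiff (contDiff_norm_sq ℝ) fun z => ?_
  have : 0 < ε ^ 2 := by positivity
  exact lt_of_lt_of_le (neg_lt_zero.2 this) (by positivity)

theorem complexLaplacian_Phi (β : ℝ) {ε : ℝ} (hε : 0 < ε) (z : ℂ) :
    complexLaplacian (Phi β ε) z = 4 * β ^ 2 * (ε ^ 2 + ‖z‖ ^ 2) ^ (β - 1) := by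
  have hε2 : 0 < ε ^ 2 := by positivity
  set f : ℝ → ℝ := fun r => (ε ^ 2 + r) ^ β
  set t := ‖z‖ ^ 2
  have ht0 : 0 ≤ t := by positivity
  have hεt : -ε ^ 2 < t := by linarith
  have hq : HasDerivAt (dslope f 0) (deriv (dslope f 0) t) t :=
    (analyticAt_dslope_add_rpow_const β hε2 hεt).differentiableAt.hasDerivAt
  have hΔ := complexLaplacian_comp_norm_sq
    ((eventually_gt_nhds hεt).mono fun s hs => hasDerivAt_chi β hε hs) (hq.const_mul β)
  have hprod : HasDerivAt (fun s => f s - f 0) (1 * dslope f 0 t + t * deriv (dslope f 0) t) t := by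
    have h := (hasDerivAt_id t).fun_mul hq
    refine h.congr_of_eventuallyEq (.of_forall fun s => ?_)
    simpa using (sub_smul_dslope f 0 s).symm
  have hpow : HasDerivAt (fun s => f s - f 0) (1 * β * (ε ^ 2 + t) ^ (β - 1)) t :=
    (((hasDerivAt_id t).const_add (ε ^ 2)).rpow_const (.inl (by simp; linarith))).sub_const _
  have key := hprod.unique hpow
  calc complexLaplacian (Phi β ε) z
      = 4 * (β * dslope f 0 t + t * (β * deriv (dslope f 0) t)) := hΔ
    _ = 4 * β ^ 2 * (ε ^ 2 + t) ^ (β - 1) := by linear_combination 4 * β * key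

theorem Phi_smooth_laplacian (β ε : ℝ) (hβ : β ∈ Set.Ioo (0:ℝ) 1) (hε : 0 < ε) :
    ContDiff ℝ (⊤ : ℕ∞) (Phi β ε) ∧
    (∀ z : ℂ, complexLaplacian (Phi β ε) z = 4 * β ^ 2 * (ε ^ 2 + ‖z‖ ^ 2) ^ (β - 1)) ∧
    (∀ z : ℂ, 0 < complexLaplacian (Phi β ε) z) ∧
    IsSubharmonic (Phi β ε) := by
  have hpos : ∀ z : ℂ, 0 < complexLaplacian (Phi β ε) z := fun z => by
    have := hβ.1
    rw [complexLaplacian_Phi β hε]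
    positivity
  exact ⟨contDiff_Phi β hε, complexLaplacian_Phi β hε, hpos,
    (contDiff_Phi β hε).of_le (WithTop.coe_le_coe.2 le_top), fun z => (hpos z).le⟩
end
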